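/- (Convergence of the generalized block qd-algorithm, multiple eigenvalue case.) Suppose the discrete non-commutative hungry Toda-II lattice equations with zero boundary conditions hold at every step α ∈ ℕ. Regard J_n^{(0)} as a complex np×np matrix and suppose it is diagonalizable: J_n^{(0)} = X·D·X^{−1}, where D is diagonal, listing s < np distinct eigenvalues λ_1,…,λ_s with |λ_1| > ⋯ > |λ_s| > 0, each λ_i repeated consecutively with multiplicity η_i and Σ_{i=1}^{s} η_i = np. Suppose Y := X^{−1} admits a block LU factorization Y = L_Y·U_Y with L_Y unit block lower triangular and U_Y block upper triangular (with p×p blocks). Define the unit lower triangular matrix L̃ by L̃_{a,b} := (L_Y)_{a,b} if D_{a,a} = D_{b,b} and L̃_{a,b} := 0 otherwise, for a > b (diagonal entries equal 1). Suppose that for each k = 1,…,n−1 the leading principal kp×kp submatrices of X, of X^{−1}, and of X·L̃ are invertible. Then J_n^{(θα)} converges as α → ∞ to a block upper bidiagonal matrix: every p×p block of J_n^{(θα)} strictly below the block diagonal tends to 0, every block strictly above the block superdiagonal is 0, every block on the block superdiagonal equals I_p, and the diagonal blocks q_m^{(θα)} converge as α → ∞. -/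

import Mathlib

open Matrix Filter

/-- The block upper bidiagonal matrix `R_n^{(α)}`: diagonal blocks
`q_1^{(α)}, …, q_n^{(α)}`, superdiagonal blocks `I_p`, zero elsewhere,
realized as an `np × np` real matrix indexed by `Fin n × Fin p`. -/
def blkR (p n : ℕ) (q : ℕ → ℕ → Matrix (Fin p) (Fin p) ℝ) (α : ℕ) :
    Matrix (Fin n × Fin p) (Fin n × Fin p) ℝ :=
  Matrix.of fun u v =>
    if u.1 = v.1 then q ((u.1 : ℕ) + 1) α u.2 v.2
    else if (v.1 : ℕ) = (u.1 : ℕ) + 1 then (if u.2 = v.2 then 1 else 0) else 0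

/-- The block lower bidiagonal matrix `L_n^{(α)}`: diagonal blocks `I_p`,
subdiagonal blocks `e_1^{(α)}, …, e_{n-1}^{(α)}`, zero elsewhere. -/
def blkL (p n : ℕ) (e : ℕ → ℕ → Matrix (Fin p) (Fin p) ℝ) (α : ℕ) :
    Matrix (Fin n × Fin p) (Fin n × Fin p) ℝ :=
  Matrix.of fun u v =>
    if u.1 = v.1 then (if u.2 = v.2 then 1 else 0)
    else if (u.1 : ℕ) = (v.1 : ℕ) + 1 then e (u.1 : ℕ) α u.2 v.2 else 0

/-- The discrete non-commutative hungry Toda-II lattice with zero boundary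
conditions, at time step `α`. -/
def TodaStep (p θ : ℕ) (q e : ℕ → ℕ → Matrix (Fin p) (Fin p) ℝ) (n α : ℕ) : Prop :=
  (∀ m : ℕ, 1 ≤ m → m ≤ n → q m (α + 1) + e (m - 1) (α + θ) = q m α + e m α) ∧
  (∀ m : ℕ, 1 ≤ m → m ≤ n - 1 → e m (α + θ) * q m (α + 1) = q (m + 1) α * e m α)

/-- The block Hessenberg matrix
`J_n^{(α)} = L_n^{(α)} · L_n^{(α+1)} ⋯ L_n^{(α+θ-1)} · R_n^{(α)}`. -/
def blkJ (p n θ : ℕ) (q e : ℕ → ℕ → Matrix (Fin p) (Fin p) ℝ) (α : ℕ) :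
    Matrix (Fin n × Fin p) (Fin n × Fin p) ℝ :=
  ((List.range θ).map fun i => blkL p n e (α + i)).prod * blkR p n q α

section helpers

/-- Unit block lower triangular matrices. -/
def ULow {n p : ℕ} (M : Matrix (Fin n × Fin p) (Fin n × Fin p) ℂ) : Prop :=
  ∀ u v, u.1 ≤ v.1 → M u v = (1 : Matrix (Fin n × Fin p) (Fin n × Fin p) ℂ) u v

variable {n p : ℕ}

theorem ULow.one : ULow (1 : Matrix (Fin n × Fin p) (Fin n × Fin p) ℂ) := fun _ _ _ => rfl

theorem ULow.mul {A B : Matrix (Fin n × Fin p) (Fin n × Fin p) ℂ} (hA : ULow A) (hB : ULow B) :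
    ULow (A * B) := by
  intro u v huv
  rw [Matrix.mul_apply, Finset.sum_eq_single u]
  · rw [hA u u le_rfl, hB u v huv]; simp
  · intro w _ hw
    by_cases h : u.1 ≤ w.1
    · rw [hA u w h, Matrix.one_apply_ne (Ne.symm hw), zero_mul]
    · push Not at h
      rw [hB w v (h.le.trans huv), Matrix.one_apply_ne, mul_zero]
      rintro rfl
      exact absurd huv (not_le.2 h)
  · simp

theorem ULow.tri {A : Matrix (Fin n × Fin p) (Fin n × Fin p) ℂ} (hA : ULow A) :
    A.BlockTriangular (fun u => OrderDual.toDual u.1) := by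
  intro u v h
  have h' : u.1 < v.1 := h
  rw [hA u v h'.le, Matrix.one_apply_ne]
  rintro rfl
  exact lt_irrefl _ h'

theorem ULow.det {A : Matrix (Fin n × Fin p) (Fin n × Fin p) ℂ} (hA : ULow A) : A.det = 1 := by
  rw [hA.tri.det]
  refine Finset.prod_eq_one fun a _ => ?_
  have : A.toSquareBlock (fun u => OrderDual.toDual u.1) a = 1 := by
    ext u v
    have h1 := u.2
    have h2 := v.2
    have h3 : u.1.1 = v.1.1 := OrderDual.toDual.injective (h1.trans h2.symm)
    rw [Matrix.toSquareBlock_def, Matrix.of_apply, hA _ _ h3.le, Matrix.one_apply, Matrix.one_apply]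
    simp [Subtype.ext_iff]
  rw [this, Matrix.det_one]

theorem ULow.unit {A : Matrix (Fin n × Fin p) (Fin n × Fin p) ℂ} (hA : ULow A) :
    IsUnit A.det := by
  rw [hA.det]; exact isUnit_one

theorem ULow.inv {A : Matrix (Fin n × Fin p) (Fin n × Fin p) ℂ} (hA : ULow A) : ULow A⁻¹ := by
  let _ := Matrix.invertibleOfIsUnitDet A hA.unit
  have ht := Matrix.blockTriangular_inv_of_blockTriangular hA.tri
  intro u v huv
  rw [← Matrix.mul_nonsing_inv A hA.unit, Matrix.mul_apply, Finset.sum_eq_single u]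
  · rw [hA u u le_rfl]; simp
  · intro w _ hw
    by_cases h : u.1 ≤ w.1
    · rw [hA u w h, Matrix.one_apply_ne (Ne.symm hw), zero_mul]
    · push Not at h
      rw [ht (show OrderDual.toDual v.1 < OrderDual.toDual w.1 from h.trans_le huv), mul_zero]
  · simp

theorem tendsto_matrix_inv {ι : Type*} [Fintype ι] [DecidableEq ι] {f : ℕ → Matrix ι ι ℂ}
    {A : Matrix ι ι ℂ} (hf : Tendsto f atTop (nhds A)) (hA : IsUnit A.det) :
    Tendsto (fun k => (f k)⁻¹) atTop (nhds A⁻¹) := by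
  refine (continuousAt_matrix_inv A ?_).tendsto.comp hf
  exact NormedRing.inverse_continuousAt hA.unit

theorem tendsto_matrix_of {κ κ' K : Type*} [TopologicalSpace K] {f : ℕ → Matrix κ κ' K}
    {A : Matrix κ κ' K} (h : ∀ u v, Tendsto (fun k => f k u v) atTop (nhds (A u v))) :
    Tendsto f atTop (nhds A) :=
  tendsto_pi_nhds.2 fun u => tendsto_pi_nhds.2 fun v => h u v

theorem tendsto_matrix_elem {κ κ' K : Type*} [TopologicalSpace K] {f : ℕ → Matrix κ κ' K}
    {A : Matrix κ κ' K} (h : Tendsto f atTop (nhds A)) (u : κ) (v : κ') :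
    Tendsto (fun k => f k u v) atTop (nhds (A u v)) :=
  tendsto_pi_nhds.1 (tendsto_pi_nhds.1 h u) v

theorem row_lim {κ : Type*} [Fintype κ] [DecidableEq κ] {A : ℕ → Matrix κ κ ℂ}
    {B : Matrix κ κ ℂ} {r b : ℕ → κ → ℂ} {c : κ → ℂ}
    (hA : Tendsto A atTop (nhds B)) (hB : IsUnit B.det)
    (hr : ∀ k, r k ᵥ* A k = b k) (hb : ∀ w, Tendsto (fun k => b k w) atTop (nhds (c w)))
    (w : κ) : ∃ x : ℂ, Tendsto (fun k => r k w) atTop (nhds x) := by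
  have hinv := tendsto_matrix_inv hA hB
  have hev : ∀ᶠ k in atTop, IsUnit (A k).det := by
    have h1 : Tendsto (fun k => (A k).det) atTop
        (nhds B.det) := ((continuous_id.matrix_det).tendsto _).comp hA
    have := h1.eventually_ne hB.ne_zero
    filter_upwards [this] with k hk
    exact isUnit_iff_ne_zero.2 hk
  have hsum : Tendsto (fun k => ∑ z, b k z * (A k)⁻¹ z w) atTop
      (nhds (∑ z, c z * B⁻¹ z w)) :=
    tendsto_finsetSum _ fun z _ =>
      (hb z).mul (((continuous_id.matrix_elem z w).tendsto _).comp hinv)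
  refine ⟨_, hsum.congr' ?_⟩
  filter_upwards [hev] with k hk'
  have : b k ᵥ* (A k)⁻¹ = r k := by
    rw [← hr k, Matrix.vecMul_vecMul, Matrix.mul_nonsing_inv _ hk', Matrix.vecMul_one]
  rw [← this]
  rfl

theorem core (W Λ U : ℕ → Matrix (Fin n × Fin p) (Fin n × Fin p) ℂ)
    (V : Matrix (Fin n × Fin p) (Fin n × Fin p) ℂ)
    (hW : Tendsto W atTop (nhds V)) (hΛ : ∀ k, ULow (Λ k))
    (hU : ∀ k, (U k).BlockTriangular (fun u => u.1))
    (hWk : ∀ k, W k = Λ k * U k)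
    (hV : ∀ k : ℕ, 1 ≤ k → ∀ hk : k < n,
      IsUnit (V.submatrix
          (fun w : Fin k × Fin p => ((⟨(w.1 : ℕ), lt_trans w.1.2 hk⟩ : Fin n), w.2))
          (fun w : Fin k × Fin p => ((⟨(w.1 : ℕ), lt_trans w.1.2 hk⟩ : Fin n), w.2)))) :
    ∃ M, ULow M ∧ (M * V).BlockTriangular (fun u => u.1) ∧
      Tendsto (fun k => (Λ k)⁻¹) atTop (nhds M) := by
  have hMW : ∀ k, (Λ k)⁻¹ * W k = U k := fun k => by
    rw [hWk, ← Matrix.mul_assoc, Matrix.nonsing_inv_mul _ (hΛ k).unit, Matrix.one_mul]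
  have key : ∀ u v, ∃ x : ℂ, Tendsto (fun k => (Λ k)⁻¹ u v) atTop (nhds x) := by
    intro u v
    by_cases huv : u.1 ≤ v.1
    · refine ⟨(1 : Matrix (Fin n × Fin p) (Fin n × Fin p) ℂ) u v, ?_⟩
      simp only [(hΛ _).inv u v huv]
      exact tendsto_const_nhds
    push Not at huv
    have hlt : (v.1 : ℕ) < (u.1 : ℕ) := huv
    have hk : (u.1 : ℕ) < n := u.1.2
    have hdet := hV u.1 (by omega) hk
    set f : Fin u.1 × Fin p → Fin n × Fin p :=
      fun w => ((⟨(w.1 : ℕ), lt_trans w.1.2 hk⟩ : Fin n), w.2) with hf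
    have hfinj : Function.Injective f := by
      rintro ⟨a, b⟩ ⟨c, d⟩ h
      simp only [hf, Prod.mk.injEq, Fin.mk.injEq] at h
      exact Prod.ext (Fin.ext h.1) h.2
    have hsub : Tendsto (fun k => (W k).submatrix f f) atTop (nhds (V.submatrix f f)) :=
      ((continuous_id.matrix_submatrix f f).tendsto V).comp hW
    have hdet' := (Matrix.isUnit_iff_isUnit_det _).1 hdet
    have hrow : ∀ k, (fun w => (Λ k)⁻¹ u (f w)) ᵥ* (W k).submatrix f f
        = fun w => - W k u (f w) := by
      intro k
      funext w'
      have h0 : ((Λ k)⁻¹ * W k) u (f w') = 0 := by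
        rw [hMW]; exact hU k (show (f w').1 < u.1 from w'.1.2)
      have h1 : (((Λ k)⁻¹ - 1) * W k) u (f w') = - W k u (f w') := by
        rw [Matrix.sub_mul, Matrix.sub_apply, h0, Matrix.one_mul, zero_sub]
      rw [← h1, Matrix.mul_apply]
      refine Fintype.sum_of_injective f hfinj _ _ ?_ ?_
      · intro z hz
        have : u.1 ≤ z.1 := by
          by_contra hc
          push Not at hc
          exact hz ⟨(⟨z.1, hc⟩, z.2), rfl⟩
        rw [Matrix.sub_apply, (hΛ k).inv u z this, sub_self, zero_mul]
      · intro w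
        rw [Matrix.sub_apply, Matrix.one_apply_ne, sub_zero]
        · rfl
        intro h
        have h2 : (f w).1 < u.1 := w.1.2
        rw [← h] at h2
        exact lt_irrefl _ h2
    have hr : ∀ w, Tendsto (fun k => - W k u (f w)) atTop (nhds (- V u (f w))) := fun w =>
      (((continuous_id.matrix_elem u (f w)).tendsto V).comp hW).neg
    exact row_lim hsub hdet' hrow hr (⟨v.1, hlt⟩, v.2)
  choose M hM using key
  have hlim : Tendsto (fun k => (Λ k)⁻¹) atTop (nhds (Matrix.of M)) := by
    exact tendsto_matrix_of hM
  refine ⟨Matrix.of M, ?_, ?_, hlim⟩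
  · intro u v huv
    refine tendsto_nhds_unique (hM u v) ?_
    simp only [(hΛ _).inv u v huv]
    exact tendsto_const_nhds
  · intro u v huv
    have h1 := hlim.mul hW
    have h2 := ((continuous_id.matrix_elem u v).tendsto _).comp h1
    refine tendsto_nhds_unique h2 ?_
    have : ∀ k, (id ((Λ k)⁻¹ * W k)) u v = 0 := fun k => by
      rw [hMW]; exact hU k huv
    simp only [Function.comp_def, id] at this ⊢
    simp only [this]
    exact tendsto_const_nhds

theorem blkL_mul (e : ℕ → ℕ → Matrix (Fin p) (Fin p) ℝ) (α : ℕ)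
    (M : Matrix (Fin n × Fin p) (Fin n × Fin p) ℝ) (i : Fin n) (a : Fin p) (v : Fin n × Fin p) :
    (blkL p n e α * M) (i, a) v = M (i, a) v +
      ∑ k : Fin n, if (i : ℕ) = k + 1 then ∑ b, e i α a b * M (k, b) v else 0 := by
  have h1 : M (i, a) v = ∑ k : Fin n, if i = k then M (k, a) v else 0 := by simp
  rw [h1, ← Finset.sum_add_distrib, Matrix.mul_apply, Fintype.sum_prod_type]
  refine Finset.sum_congr rfl fun k _ => ?_
  by_cases hik : i = k
  · subst hik
    simp [blkL]
  · by_cases h2 : (i : ℕ) = k + 1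
    · simp [blkL, hik, h2]
    · simp [blkL, hik, h2]

theorem blkR_mul (q : ℕ → ℕ → Matrix (Fin p) (Fin p) ℝ) (α : ℕ)
    (M : Matrix (Fin n × Fin p) (Fin n × Fin p) ℝ) (i : Fin n) (a : Fin p) (v : Fin n × Fin p) :
    (blkR p n q α * M) (i, a) v = (∑ b, q (i + 1) α a b * M (i, b) v) +
      ∑ k : Fin n, if (k : ℕ) = i + 1 then M (k, a) v else 0 := by
  have h1 : (∑ b, q (i + 1) α a b * M (i, b) v)
      = ∑ k : Fin n, if i = k then (∑ b, q (i + 1) α a b * M (k, b) v) else 0 := by simp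
  rw [h1, ← Finset.sum_add_distrib, Matrix.mul_apply, Fintype.sum_prod_type]
  refine Finset.sum_congr rfl fun k _ => ?_
  by_cases hik : i = k
  · subst hik
    simp [blkR]
  · by_cases h2 : (k : ℕ) = i + 1
    · simp [blkR, hik, h2]
    · simp [blkR, hik, h2]

theorem sum_pred (g : Fin n → ℝ) (i : Fin n) :
    (∑ k : Fin n, if (i : ℕ) = k + 1 then g k else 0)
      = if h : 0 < (i : ℕ) then g ⟨i - 1, by omega⟩ else 0 := by
  split_ifs with h
  · rw [Finset.sum_eq_single ⟨i - 1, by omega⟩]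
    · rw [if_pos]; simp only; omega
    · intro b _ hb
      rw [if_neg]
      intro h'
      exact hb (Fin.ext (by simp only; omega))
    · simp
  · refine Finset.sum_eq_zero fun k _ => if_neg (by omega)

theorem sum_succ' (g : Fin n → ℝ) (i : Fin n) :
    (∑ k : Fin n, if (k : ℕ) = i + 1 then g k else 0)
      = if h : (i : ℕ) + 1 < n then g ⟨i + 1, h⟩ else 0 := by
  split_ifs with h
  · rw [Finset.sum_eq_single ⟨i + 1, h⟩]
    · simp
    · intro b _ hb
      rw [if_neg]
      intro h'
      exact hb (Fin.ext h')
    · simp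
  · refine Finset.sum_eq_zero fun k _ => if_neg (by omega)

theorem lax {θ : ℕ} {q e : ℕ → ℕ → Matrix (Fin p) (Fin p) ℝ}
    (hbd : ∀ α : ℕ, e 0 α = 0 ∧ e n α = 0) (α : ℕ) (h : TodaStep p θ q e n α) :
    blkR p n q α * blkL p n e α = blkL p n e (α + θ) * blkR p n q (α + 1) := by
  obtain ⟨h1, h2⟩ := h
  ext ⟨i, a⟩ ⟨j, b⟩
  rw [blkR_mul, blkL_mul, sum_pred, sum_succ']
  have hi := i.2
  have hj := j.2
  simp only [blkL, blkR, Matrix.of_apply, @Fin.ext_iff n]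
  rcases lt_trichotomy (i : ℕ) j with hij | hij | hij
  · by_cases hs : (j : ℕ) = i + 1
    · have e1 : ¬ ((i : ℕ) = j) := by omega
      have e2 : ¬ ((i : ℕ) = j + 1) := by omega
      have e4 : (i : ℕ) + 1 < n := by omega
      have e5 : ¬ ((i : ℕ) - 1 = j) := by omega
      have e6 : 0 < (i : ℕ) → ¬ ((j : ℕ) = (i - 1) + 1) := by omega
      by_cases h0 : 0 < (i : ℕ)
      · have e7 : ¬ ((i : ℕ) = i - 1) := by omega
        have e8 : ¬ ((i : ℕ) + 1 = i - 1 + 1) := by omega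
        simp [e1, hs, e4, h0, e5, e7, e8]
        try omega
      · have e9 : ¬ ((i : ℕ) = i + 1 + 1) := by omega
        simp [hs, e4, h0, e9]
    · have e1 : ¬ ((i : ℕ) = j) := by omega
      have e2 : ¬ ((i : ℕ) = j + 1) := by omega
      have e3 : ¬ ((i : ℕ) + 1 = j) := by omega
      have e5 : ¬ ((i : ℕ) - 1 = j) := by omega
      have e6 : ¬ ((j : ℕ) = (i - 1) + 1) := by omega
      simp [e1, e2, e3, e5, e6, hs]
  · obtain rfl : i = j := Fin.ext hij
    have hm := h1 (i + 1) (by omega) (by omega)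
    have hm' := congrFun (congrFun hm a) b
    simp only [Matrix.add_apply, Nat.add_sub_cancel] at hm'
    have t1 : (if h : (i : ℕ) + 1 < n then e (i + 1) α a b else 0) = e (i + 1) α a b := by
      split_ifs with h
      · rfl
      · have : (i : ℕ) + 1 = n := by omega
        rw [this, (hbd α).2]; rfl
    have t2 : (if h : 0 < (i : ℕ) then e i (α + θ) a b else 0) = e i (α + θ) a b := by
      split_ifs with h
      · rfl
      · have : (i : ℕ) = 0 := by omega
        rw [this, (hbd _).1]; rfl
    have e8 : 0 < (i : ℕ) → (i : ℕ) = i - 1 + 1 := by omega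
    have e9 : 0 < (i : ℕ) → ¬ ((i : ℕ) - 1 = i) := by omega
    rw [← t1, ← t2] at hm'
    by_cases h0 : 0 < (i : ℕ)
    · simp [h0, e9 h0, ← e8 h0] at hm' ⊢
      exact hm'.symm
    · simp [h0] at hm' ⊢
      exact hm'.symm
  · have e1 : ¬ ((i : ℕ) = j) := by omega
    have e2 : ¬ ((i : ℕ) + 1 = j) := by omega
    have e3 : ¬ ((j : ℕ) = i + 1) := by omega
    have h0 : 0 < (i : ℕ) := by omega
    by_cases hs : (i : ℕ) = j + 1
    · have hm := h2 i (by omega) (by omega)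
      have hm' := congrFun (congrFun hm a) b
      simp only [Matrix.mul_apply] at hm'
      have e4 : (i : ℕ) - 1 = j := by omega
      have e5 : (i : ℕ) - 1 + 1 = i := by omega
      have e6 : ¬ ((j : ℕ) + 1 + 1 = j) := by omega
      have e7 : ¬ ((j : ℕ) = j + 1 + 1) := by omega
      simp only [hs] at hm' ⊢
      simp [e6, e7]
      exact hm'.symm
    · have e4 : ¬ ((i : ℕ) - 1 = j) := by omega
      have e5 : ¬ ((j : ℕ) = i - 1 + 1) := by omega
      simp [e1, e2, e3, e4, e5, hs]

end helpers

section mainpart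

theorem main_cx {n p : ℕ} (P R : ℕ → Matrix (Fin n × Fin p) (Fin n × Fin p) ℂ)
    (hP : ∀ k, ULow (P k)) (hR : ∀ k, (R k).BlockTriangular (fun u => u.1))
    (hlax : ∀ k, P (k + 1) * R (k + 1) = R k * P k)
    (X : Matrix (Fin n × Fin p) (Fin n × Fin p) ℂ)
    (lam : Fin n × Fin p → ℂ)
    (hX : IsUnit X)
    (hdecomp : P 0 * R 0 = X * diagonal lam * X⁻¹)
    (hlam0 : ∀ u : Fin n × Fin p, lam u ≠ 0)
    (hlam : ∀ u v : Fin n × Fin p, u.1 < v.1 → lam u = lam v ∨ ‖lam v‖ < ‖lam u‖)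
    (LY UY : Matrix (Fin n × Fin p) (Fin n × Fin p) ℂ)
    (hLY : ULow LY)
    (hUY : UY.BlockTriangular (fun u => u.1))
    (hfac : X⁻¹ = LY * UY)
    (Lt : Matrix (Fin n × Fin p) (Fin n × Fin p) ℂ)
    (hLt : ∀ u v : Fin n × Fin p, Lt u v = if lam u = lam v then LY u v else 0)
    (hprin : ∀ k : ℕ, 1 ≤ k → ∀ hk : k < n,
      IsUnit ((X * Lt).submatrix
          (fun w : Fin k × Fin p => ((⟨(w.1 : ℕ), lt_trans w.1.2 hk⟩ : Fin n), w.2))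
          (fun w : Fin k × Fin p => ((⟨(w.1 : ℕ), lt_trans w.1.2 hk⟩ : Fin n), w.2)))) :
    ∃ J : Matrix (Fin n × Fin p) (Fin n × Fin p) ℂ, J.BlockTriangular (fun u => u.1) ∧
      Tendsto (fun k => P k * R k) atTop (nhds J) ∧ Tendsto R atTop (nhds J) := by
  have hXd : IsUnit X.det := (Matrix.isUnit_iff_isUnit_det _).1 hX
  -- accumulated factors
  let Λ : ℕ → Matrix (Fin n × Fin p) (Fin n × Fin p) ℂ := fun k => Nat.rec 1 (fun k A => A * P k) k
  let U : ℕ → Matrix (Fin n × Fin p) (Fin n × Fin p) ℂ := fun k => Nat.rec 1 (fun k A => R k * A) k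
  have hΛ0 : Λ 0 = 1 := rfl
  have hU0 : U 0 = 1 := rfl
  have hΛs : ∀ k, Λ (k + 1) = Λ k * P k := fun _ => rfl
  have hUs : ∀ k, U (k + 1) = R k * U k := fun _ => rfl
  clear_value Λ U
  have hΛ : ∀ k, ULow (Λ k) := by
    intro k
    induction k with
    | zero => rw [hΛ0]; exact ULow.one
    | succ k ih => rw [hΛs]; exact ih.mul (hP k)
  have hU : ∀ k, (U k).BlockTriangular (fun u => u.1) := by
    intro k
    induction k with
    | zero => rw [hU0]; exact Matrix.blockTriangular_one
    | succ k ih => rw [hUs]; exact (hR k).mul ih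
  have hconj : ∀ k, Λ k * (P k * R k) = (P 0 * R 0) * Λ k := by
    intro k
    induction k with
    | zero => rw [hΛ0, Matrix.one_mul, Matrix.mul_one]
    | succ k ih =>
      rw [hΛs, hlax, ← Matrix.mul_assoc (P 0 * R 0), ← ih]
      simp only [Matrix.mul_assoc]
  have hpow : ∀ k, (P 0 * R 0) ^ k = Λ k * U k := by
    intro k
    induction k with
    | zero => rw [hΛ0, hU0, pow_zero, Matrix.one_mul]
    | succ k ih =>
      rw [pow_succ', ih, ← Matrix.mul_assoc, ← hconj, hΛs, hUs]
      simp only [Matrix.mul_assoc]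
  have hpow2 : ∀ k, (P 0 * R 0) ^ k = X * diagonal (fun u => lam u ^ k) * X⁻¹ := by
    intro k
    induction k with
    | zero => simp [Matrix.mul_nonsing_inv _ hXd]
    | succ k ih =>
      rw [pow_succ, ih, hdecomp]
      have : X * diagonal (fun u => lam u ^ k) * X⁻¹ * (X * diagonal lam * X⁻¹)
          = X * diagonal (fun u => lam u ^ k) * (X⁻¹ * X) * diagonal lam * X⁻¹ := by
        simp only [Matrix.mul_assoc]
      rw [this, Matrix.nonsing_inv_mul _ hXd, Matrix.mul_one, Matrix.mul_assoc X,
        Matrix.diagonal_mul_diagonal]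
      simp only [pow_succ]
  let G : ℕ → Matrix (Fin n × Fin p) (Fin n × Fin p) ℂ :=
    fun k => Matrix.of fun u v => (lam u / lam v) ^ k * LY u v
  have hG : ∀ k, G k * diagonal (fun u => lam u ^ k) = diagonal (fun u => lam u ^ k) * LY := by
    intro k
    ext u v
    rw [Matrix.mul_diagonal, Matrix.diagonal_mul]
    simp only [G, Matrix.of_apply]
    have := pow_ne_zero k (hlam0 v)
    rw [div_pow]
    field_simp
  have hGlim : Tendsto G atTop (nhds Lt) := by
    refine tendsto_matrix_of fun u v => ?_
    simp only [G, Matrix.of_apply]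
    rw [hLt]
    by_cases h : lam u = lam v
    · rw [if_pos h, h, div_self (hlam0 v)]
      simp only [one_pow, one_mul]
      exact tendsto_const_nhds
    rw [if_neg h]
    by_cases huv : u.1 ≤ v.1
    · rw [hLY u v huv, Matrix.one_apply_ne (by rintro rfl; exact h rfl)]
      simp only [mul_zero]
      exact tendsto_const_nhds
    · push Not at huv
      have hn : ‖lam u / lam v‖ < 1 := by
        rw [norm_div, div_lt_one (norm_pos_iff.2 (hlam0 v))]
        rcases hlam v u huv with h' | h'
        · exact absurd h'.symm h
        · exact h'
      have := (tendsto_pow_atTop_nhds_zero_of_norm_lt_one hn).mul_const (LY u v)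
      rwa [zero_mul] at this
  have hUYd : IsUnit UY.det := by
    have h1 : IsUnit (X⁻¹).det := Matrix.isUnit_nonsing_inv_det X hXd
    rw [hfac, Matrix.det_mul, hLY.det, one_mul] at h1
    exact h1
  have hUYi : (UY⁻¹).BlockTriangular (fun u => u.1) := by
    let _ := Matrix.invertibleOfIsUnitDet UY hUYd
    exact Matrix.blockTriangular_inv_of_blockTriangular hUY
  have hW : ∀ k, X * G k = Λ k * (U k * UY⁻¹ * diagonal (fun u => (lam u ^ k)⁻¹)) := by
    intro k
    have h1 : Λ k * U k = X * G k * diagonal (fun u => lam u ^ k) * UY := by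
      rw [← hpow, hpow2, hfac, Matrix.mul_assoc X (G k), hG]
      simp only [Matrix.mul_assoc]
    have h2 : diagonal (fun u => lam u ^ k) * diagonal (fun u => (lam u ^ k)⁻¹) = 1 := by
      rw [Matrix.diagonal_mul_diagonal, ← Matrix.diagonal_one]
      congr 1
      funext u
      exact mul_inv_cancel₀ (pow_ne_zero k (hlam0 u))
    have h3 : Λ k * (U k * UY⁻¹ * diagonal (fun u => (lam u ^ k)⁻¹))
        = (Λ k * U k) * UY⁻¹ * diagonal (fun u => (lam u ^ k)⁻¹) := by
      simp only [Matrix.mul_assoc]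
    rw [h3, h1, Matrix.mul_assoc _ UY, Matrix.mul_nonsing_inv _ hUYd, Matrix.mul_one,
      Matrix.mul_assoc (X * G k), h2, Matrix.mul_one]
  obtain ⟨M, hM, hMV, hlim⟩ := core (fun k => X * G k) Λ
    (fun k => U k * UY⁻¹ * diagonal (fun u => (lam u ^ k)⁻¹)) (X * Lt)
    (tendsto_const_nhds.mul hGlim) hΛ
    (fun k => ((hU k).mul hUYi).mul (Matrix.blockTriangular_diagonal _)) hW hprin
  have hLtU : ULow Lt := by
    intro u v huv
    rw [hLt, hLY u v huv]
    by_cases h : u = v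
    · subst h; simp
    · simp [Matrix.one_apply_ne h]
  have hLtD : Lt * diagonal lam = diagonal lam * Lt := by
    ext u v
    rw [Matrix.mul_diagonal, Matrix.diagonal_mul, hLt]
    split_ifs with h
    · rw [h, mul_comm]
    · simp
  have hΛlim : Tendsto Λ atTop (nhds M⁻¹) := by
    have := tendsto_matrix_inv hlim hM.unit
    simpa only [Matrix.nonsing_inv_nonsing_inv _ (hΛ _).unit] using this
  have hJk : ∀ k, P k * R k = (Λ k)⁻¹ * (P 0 * R 0) * Λ k := by
    intro k
    rw [Matrix.mul_assoc, ← hconj, ← Matrix.mul_assoc, Matrix.nonsing_inv_mul _ (hΛ k).unit,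
      Matrix.one_mul]
  have hJlim : Tendsto (fun k => P k * R k) atTop (nhds (M * (P 0 * R 0) * M⁻¹)) := by
    have := (hlim.mul (tendsto_const_nhds (x := P 0 * R 0))).mul hΛlim
    exact this.congr fun k => (hJk k).symm
  have hPlim : Tendsto P atTop (nhds 1) := by
    have := hlim.mul (hΛlim.comp (tendsto_add_atTop_nat 1))
    rw [Matrix.mul_nonsing_inv _ hM.unit] at this
    refine this.congr fun k => ?_
    simp only [Function.comp]
    rw [hΛs, ← Matrix.mul_assoc, Matrix.nonsing_inv_mul _ (hΛ k).unit, Matrix.one_mul]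
  refine ⟨M * (P 0 * R 0) * M⁻¹, ?_, hJlim, ?_⟩
  · have hd : IsUnit (M * (X * Lt)).det := by
      rw [Matrix.det_mul, Matrix.det_mul, hM.det, hLtU.det]
      simpa using hXd
    have hi : ((M * (X * Lt))⁻¹).BlockTriangular (fun u => u.1) := by
      let _ := Matrix.invertibleOfIsUnitDet _ hd
      exact Matrix.blockTriangular_inv_of_blockTriangular hMV
    have heq : M * (P 0 * R 0) * M⁻¹ = (M * (X * Lt)) * diagonal lam * (M * (X * Lt))⁻¹ := by
      have h1 : M * (P 0 * R 0) * M⁻¹ * (M * (X * Lt)) = (M * (X * Lt)) * diagonal lam := by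
        have h2 : M * (P 0 * R 0) * M⁻¹ * (M * (X * Lt))
            = M * (P 0 * R 0) * (M⁻¹ * M) * (X * Lt) := by simp only [Matrix.mul_assoc]
        have h3 : M * (X * diagonal lam * X⁻¹) * (X * Lt)
            = M * X * diagonal lam * (X⁻¹ * X) * Lt := by simp only [Matrix.mul_assoc]
        rw [h2, Matrix.nonsing_inv_mul _ hM.unit, Matrix.mul_one, hdecomp, h3,
          Matrix.nonsing_inv_mul _ hXd, Matrix.mul_one, Matrix.mul_assoc _ _ Lt, ← hLtD]
        simp only [Matrix.mul_assoc]
      rw [← h1, Matrix.mul_assoc _ (M * (X * Lt)), Matrix.mul_nonsing_inv _ hd, Matrix.mul_one]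
    rw [heq]
    exact (hMV.mul (Matrix.blockTriangular_diagonal _)).mul hi
  · have hPi := tendsto_matrix_inv hPlim (by simp)
    have := hPi.mul hJlim
    rw [inv_one, Matrix.one_mul] at this
    refine this.congr fun k => ?_
    rw [← Matrix.mul_assoc, Matrix.nonsing_inv_mul _ (hP k).unit, Matrix.one_mul]

/-- The product of `m` consecutive `L` factors. -/
def prodL (p n : ℕ) (e : ℕ → ℕ → Matrix (Fin p) (Fin p) ℝ) (α m : ℕ) :
    Matrix (Fin n × Fin p) (Fin n × Fin p) ℝ :=
  ((List.range m).map fun i => blkL p n e (α + i)).prod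

theorem prodL_succ (p n : ℕ) (e : ℕ → ℕ → Matrix (Fin p) (Fin p) ℝ) (α m : ℕ) :
    prodL p n e α (m + 1) = prodL p n e α m * blkL p n e (α + m) := by
  simp [prodL, List.range_succ]

theorem prodL_lax {p n θ : ℕ} {q e : ℕ → ℕ → Matrix (Fin p) (Fin p) ℝ}
    (hbd : ∀ α : ℕ, e 0 α = 0 ∧ e n α = 0) (htoda : ∀ α : ℕ, TodaStep p θ q e n α)
    (α m : ℕ) :
    blkR p n q α * prodL p n e α m = prodL p n e (α + θ) m * blkR p n q (α + m) := by
  induction m with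
  | zero => simp [prodL]
  | succ m ih =>
    rw [prodL_succ, prodL_succ, ← Matrix.mul_assoc, ih, Matrix.mul_assoc,
      lax hbd _ (htoda (α + m)), Matrix.mul_assoc]
    rw [show α + m + θ = α + θ + m by omega, show α + (m + 1) = α + m + 1 by omega]

theorem prodL_low (p n : ℕ) (e : ℕ → ℕ → Matrix (Fin p) (Fin p) ℝ) (α m : ℕ) :
    ULow ((prodL p n e α m).map (fun x : ℝ => (x : ℂ))) := by
  have hone : ∀ A : Matrix (Fin n × Fin p) (Fin n × Fin p) ℝ,
      A.map (fun x : ℝ => (x : ℂ)) = Complex.ofRealHom.mapMatrix A := fun _ => rfl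
  induction m with
  | zero =>
    have : prodL p n e α 0 = 1 := by simp [prodL]
    rw [this, hone, map_one]
    exact ULow.one
  | succ m ih =>
    rw [prodL_succ, hone, map_mul, ← hone, ← hone]
    refine ih.mul ?_
    intro u v huv
    have hle : (u.1 : ℕ) ≤ v.1 := huv
    simp only [blkL, Matrix.map_apply, Matrix.of_apply, Matrix.one_apply, Prod.ext_iff]
    by_cases h : u.1 = v.1
    · by_cases h' : u.2 = v.2 <;> simp [h, h']
    · have : ¬ ((u.1 : ℕ) = v.1 + 1) := by omega
      simp [h, this]

theorem blkR_upper (p n : ℕ) (q : ℕ → ℕ → Matrix (Fin p) (Fin p) ℝ) (α : ℕ) :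
    ((blkR p n q α).map (fun x : ℝ => (x : ℂ))).BlockTriangular (fun u => u.1) := by
  intro u v h
  have h' : (v.1 : ℕ) < u.1 := h
  have h1 : ¬ (u.1 = v.1) := fun h2 => by rw [h2] at h'; exact lt_irrefl _ h'
  have h2 : ¬ ((v.1 : ℕ) = u.1 + 1) := by omega
  simp [blkR, h1, h2]

theorem blkJ_upper (p n θ : ℕ) (q e : ℕ → ℕ → Matrix (Fin p) (Fin p) ℝ) (α : ℕ)
    (i j : Fin n) (hij : i < j) (a b : Fin p) :
    blkJ p n θ q e α (i, a) (j, b) = blkR p n q α (i, a) (j, b) := by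
  have hlow := prodL_low p n e α θ
  change (prodL p n e α θ * blkR p n q α) (i, a) (j, b) = _
  rw [Matrix.mul_apply, Finset.sum_eq_single (i, a)]
  · have := hlow (i, a) (i, a) le_rfl
    simp only [Matrix.map_apply, Matrix.one_apply_eq] at this
    rw [Complex.ofReal_eq_one.1 this, one_mul]
  · intro w _ hw
    by_cases h : i ≤ w.1
    · have := hlow (i, a) w h
      rw [Matrix.map_apply, Matrix.one_apply_ne (Ne.symm hw)] at this
      rw [Complex.ofReal_eq_zero.1 this, zero_mul]
    · have h1 : ¬ (w.1 = j) := by rintro rfl; omega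
      have h2 : ¬ ((j : ℕ) = w.1 + 1) := by omega
      simp [blkR, h1, h2]
  · simp

end mainpart

/-- convergence of the generalized block qd-algorithm in the
multiple-eigenvalue case: `J_n^{(θα)}` tends to a block upper bidiagonal
matrix. Equal eigenvalues are listed consecutively and distinct eigenvalues
have strictly decreasing moduli (the disjunction `hlam`); there are `s < np`
distinct eigenvalues (`hmult`); `Y = X⁻¹` has a block LU factorization
`Y = L_Y · U_Y`, and `L̃` is obtained from `L_Y` by keeping only the entries
whose corresponding eigenvalues coincide. -/
theorem statement19 (p n θ : ℕ) (hp : 1 ≤ p) (hn : 1 ≤ n) (hθ : 1 ≤ θ)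
    (q e : ℕ → ℕ → Matrix (Fin p) (Fin p) ℝ)
    (hbd : ∀ α : ℕ, e 0 α = 0 ∧ e n α = 0)
    (htoda : ∀ α : ℕ, TodaStep p θ q e n α)
    (X : Matrix (Fin n × Fin p) (Fin n × Fin p) ℂ)
    (lam : Fin n × Fin p → ℂ)
    (hX : IsUnit X)
    (hdecomp : (blkJ p n θ q e 0).map (fun x : ℝ => (x : ℂ))
        = X * diagonal lam * X⁻¹)
    (hlam0 : ∀ u : Fin n × Fin p, lam u ≠ 0)
    (hlam : ∀ u v : Fin n × Fin p,
      (u.1 : ℕ) * p + (u.2 : ℕ) < (v.1 : ℕ) * p + (v.2 : ℕ) →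
        lam u = lam v ∨ ‖lam v‖ < ‖lam u‖)
    (hmult : ∃ u v : Fin n × Fin p, u ≠ v ∧ lam u = lam v)
    (LY UY : Matrix (Fin n × Fin p) (Fin n × Fin p) ℂ)
    (hLYlow : ∀ u v : Fin n × Fin p, (u.1 : ℕ) < (v.1 : ℕ) → LY u v = 0)
    (hLYdiag : ∀ i : Fin n, ∀ a b : Fin p,
      LY (i, a) (i, b) = if a = b then 1 else 0)
    (hUY : ∀ u v : Fin n × Fin p, (v.1 : ℕ) < (u.1 : ℕ) → UY u v = 0)
    (hfac : X⁻¹ = LY * UY)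
    (Lt : Matrix (Fin n × Fin p) (Fin n × Fin p) ℂ)
    (hLt : ∀ u v : Fin n × Fin p, Lt u v = if lam u = lam v then LY u v else 0)
    (hprin : ∀ k : ℕ, 1 ≤ k → ∀ hk : k < n,
      IsUnit (X.submatrix
          (fun w : Fin k × Fin p => ((⟨(w.1 : ℕ), lt_trans w.1.2 hk⟩ : Fin n), w.2))
          (fun w : Fin k × Fin p => ((⟨(w.1 : ℕ), lt_trans w.1.2 hk⟩ : Fin n), w.2))) ∧
      IsUnit ((X⁻¹).submatrix
          (fun w : Fin k × Fin p => ((⟨(w.1 : ℕ), lt_trans w.1.2 hk⟩ : Fin n), w.2))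
          (fun w : Fin k × Fin p => ((⟨(w.1 : ℕ), lt_trans w.1.2 hk⟩ : Fin n), w.2))) ∧
      IsUnit ((X * Lt).submatrix
          (fun w : Fin k × Fin p => ((⟨(w.1 : ℕ), lt_trans w.1.2 hk⟩ : Fin n), w.2))
          (fun w : Fin k × Fin p => ((⟨(w.1 : ℕ), lt_trans w.1.2 hk⟩ : Fin n), w.2)))) :
    (∀ i j : Fin n, (j : ℕ) < (i : ℕ) →
      Tendsto
        (fun α : ℕ => Matrix.of fun a b : Fin p => blkJ p n θ q e (θ * α) (i, a) (j, b))
        atTop (nhds (0 : Matrix (Fin p) (Fin p) ℝ))) ∧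
    (∀ α : ℕ, ∀ i j : Fin n, (i : ℕ) + 1 < (j : ℕ) → ∀ a b : Fin p,
      blkJ p n θ q e (θ * α) (i, a) (j, b) = 0) ∧
    (∀ α : ℕ, ∀ i j : Fin n, (j : ℕ) = (i : ℕ) + 1 → ∀ a b : Fin p,
      blkJ p n θ q e (θ * α) (i, a) (j, b) = if a = b then 1 else 0) ∧
    (∀ m : ℕ, 1 ≤ m → m ≤ n → ∃ qlim : Matrix (Fin p) (Fin p) ℝ,
      Tendsto (fun α : ℕ => q m (θ * α)) atTop (nhds qlim)) := by
  have hone : ∀ A : Matrix (Fin n × Fin p) (Fin n × Fin p) ℝ,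
      A.map (fun x : ℝ => (x : ℂ)) = Complex.ofRealHom.mapMatrix A := fun _ => rfl
  have hJ : ∀ α, (prodL p n e α θ).map (fun x : ℝ => (x : ℂ)) *
      (blkR p n q α).map (fun x : ℝ => (x : ℂ))
      = (blkJ p n θ q e α).map (fun x : ℝ => (x : ℂ)) := by
    intro α
    rw [hone, hone, hone, ← map_mul]
    rfl
  obtain ⟨J, hJtri, hJlim, hRlim⟩ := main_cx
    (fun k => (prodL p n e (θ * k) θ).map (fun x : ℝ => (x : ℂ)))
    (fun k => (blkR p n q (θ * k)).map (fun x : ℝ => (x : ℂ)))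
    (fun k => prodL_low p n e _ _) (fun k => blkR_upper p n q _)
    (fun k => by
      rw [hone, hone, hone, hone, ← map_mul, ← map_mul, prodL_lax hbd htoda]
      rfl)
    X lam hX (by rw [hJ]; exact hdecomp) hlam0
    (fun u v huv => hlam u v (by
      have h1 : (u.1 : ℕ) + 1 ≤ v.1 := huv
      have h2 := u.2.2
      have h3 := Nat.mul_le_mul_right p h1
      rw [Nat.add_mul] at h3
      omega))
    LY UY
    (fun u v huv => by
      rcases huv.lt_or_eq with h | h
      · rw [hLYlow u v h, Matrix.one_apply_ne]
        rintro rfl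
        exact lt_irrefl _ h
      · obtain ⟨i, a⟩ := u
        obtain ⟨j, b⟩ := v
        obtain rfl : i = j := h
        rw [hLYdiag, Matrix.one_apply]
        simp)
    (fun u v h => hUY u v h) hfac Lt hLt (fun k h1 hk => (hprin k h1 hk).2.2)
  have hre : ∀ (f : ℕ → ℝ) (z : ℂ), Tendsto (fun k => (f k : ℂ)) atTop (nhds z) →
      Tendsto f atTop (nhds z.re) := by
    intro f z h
    exact (Complex.continuous_re.tendsto z).comp h
  refine ⟨?_, ?_, ?_, ?_⟩
  · intro i j hij
    refine tendsto_matrix_of fun a b => ?_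
    have h1 := tendsto_matrix_elem hJlim (i, a) (j, b)
    simp only [hJ] at h1
    have h2 := hre _ _ h1
    rw [hJtri (show j < i from hij)] at h2
    exact h2
  · intro α i j hij a b
    rw [blkJ_upper p n θ q e _ i j (by omega)]
    have h1 : ¬ (i = j) := by rintro rfl; omega
    have h2 : ¬ ((j : ℕ) = i + 1) := by omega
    simp [blkR, h1, h2]
  · intro α i j hij a b
    rw [blkJ_upper p n θ q e _ i j (by omega)]
    have h1 : ¬ (i = j) := by rintro rfl; omega
    simp [blkR, h1, hij]
  · intro m hm1 hm2
    refine ⟨Matrix.of fun a b => (J (⟨m - 1, by omega⟩, a) (⟨m - 1, by omega⟩, b)).re, ?_⟩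
    refine tendsto_matrix_of fun a b => ?_
    have h1 := hre _ _ (tendsto_matrix_elem hRlim (⟨m - 1, by omega⟩, a) (⟨m - 1, by omega⟩, b))
    have h3 : m - 1 + 1 = m := by omega
    simp only [blkR, Matrix.of_apply, if_true, h3] at h1
    exact h1
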